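/- Let G be a finite simple graph on vertex set V in which every vertex has degree at least 1, let P be a real number with P > 1, and for x : V → {0,1} and surplus variables y(v,k) ∈ {0,1} for v ∈ V and 0 ≤ k ≤ ⌊log₂ d_v⌋ define F(x,y) = Σ_{v ∈ V} x(v) + P · Σ_{v ∈ V} (1 − (x(v) + Σ_{u ∈ N(v)} x(u)) + Σ_{k=0}^{⌊log₂ d_v⌋} 2^k · y(v,k))². Then the minimum of F over all such (x,y) equals the domination number γ(G), and for every minimizer (x*, y*) the set {v ∈ V : x*(v) = 1} is a minimum dominating set of G. -/

import Mathlib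

open Finset

/-- A finset `D` is a dominating set of `G` if every vertex is in `D`
or adjacent to at least one vertex of `D`. -/
def IsDominatingSet {V : Type*} (G : SimpleGraph V) (D : Finset V) : Prop :=
  ∀ v, v ∈ D ∨ ∃ u ∈ D, G.Adj v u

/-- The domination number: the minimum cardinality of a dominating set of `G`. -/
noncomputable def dominationNumber {V : Type*} [Fintype V] (G : SimpleGraph V) : ℕ :=
  sInf {k | ∃ D : Finset V, IsDominatingSet G D ∧ D.card = k}

/-- The Dinneen–Hua QUBO objective
`F(x,y) = ∑_v x v + P ∑_v (1 - (x v + ∑_{u ∈ N(v)} x u) + ∑_{k=0}^{⌊log₂ d_v⌋} 2^k y(v,k))²`,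
evaluated in `ℝ`. -/
noncomputable def dinneenHuaF {V : Type*} [Fintype V] (G : SimpleGraph V)
    [DecidableRel G.Adj] (P : ℝ) (x : V → ℤ) (y : V → ℕ → ℤ) : ℝ :=
  (∑ v, (x v : ℝ)) + P * ∑ v,
    (((1 - (x v + ∑ u ∈ G.neighborFinset v, x u) +
      ∑ k ∈ Finset.range (Nat.log 2 (G.degree v) + 1), 2 ^ k * y v k : ℤ) : ℝ)) ^ 2

theorem sum_two_pow_mul_div_two_pow_mod_two (s n : ℕ) :
    ∑ k ∈ Finset.range n, 2 ^ k * (s / 2 ^ k % 2) = s % 2 ^ n := by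
  induction n with
  | zero => simp [Nat.mod_one]
  | succ n ih => rw [Finset.sum_range_succ, ih, Nat.mod_pow_succ]

theorem dominationNumber_le_card {V : Type*} [Fintype V] {G : SimpleGraph V} {D : Finset V}
    (hD : IsDominatingSet G D) : dominationNumber G ≤ D.card :=
  Nat.sInf_le ⟨D, hD, rfl⟩

theorem exists_isDominatingSet_card_eq_dominationNumber {V : Type*} [Fintype V]
    (G : SimpleGraph V) : ∃ D : Finset V, IsDominatingSet G D ∧ D.card = dominationNumber G :=
  Nat.sInf_mem (s := {k | ∃ D : Finset V, IsDominatingSet G D ∧ D.card = k})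
    ⟨_, Finset.univ, fun v => Or.inl (Finset.mem_univ v), rfl⟩

theorem sum_eq_card_filter_eq_one {V : Type*} [Fintype V] {x : V → ℤ}
    (hx : ∀ v, x v = 0 ∨ x v = 1) :
    ∑ v, (x v : ℝ) = ((Finset.univ.filter fun v => x v = 1).card : ℝ) := by
  rw [Finset.card_filter]
  push_cast
  refine Finset.sum_congr rfl fun v _ => ?_
  rcases hx v with h | h <;> simp [h]

/-- Every vertex left undominated by `{v | x v = 1}` costs at least `P`. -/
theorem card_add_mul_card_undominated_le_dinneenHuaF {V : Type*} [Fintype V] [DecidableEq V]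
    (G : SimpleGraph V) [DecidableRel G.Adj] {P : ℝ} (hP : 0 ≤ P) {x : V → ℤ} {y : V → ℕ → ℤ}
    (hx : ∀ v, x v = 0 ∨ x v = 1) (hy : ∀ v k, y v k = 0 ∨ y v k = 1) :
    ((Finset.univ.filter fun v => x v = 1).card : ℝ) +
        P * ((Finset.univ.filter fun v => x v = 0 ∧ ∀ u ∈ G.neighborFinset v, x u = 0).card : ℝ) ≤
      dinneenHuaF G P x y := by
  unfold dinneenHuaF
  rw [sum_eq_card_filter_eq_one hx, Finset.card_filter (fun v => x v = 0 ∧ _)]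
  push_cast
  gcongr with v
  split_ifs with h
  · have hs : (0 : ℝ) ≤ ∑ k ∈ Finset.range (Nat.log 2 (G.degree v) + 1), 2 ^ k * (y v k : ℝ) :=
      Finset.sum_nonneg fun k _ =>
        mul_nonneg (by positivity) (by rcases hy v k with h | h <;> simp [h])
    have hz : ∑ u ∈ G.neighborFinset v, (x u : ℝ) = 0 :=
      Finset.sum_eq_zero fun u hu => by rw [h.2 u hu, Int.cast_zero]
    rw [h.1, hz]
    push_cast
    nlinarith
  · positivity

theorem dominationNumber_le_card_add_card_undominated {V : Type*} [Fintype V] [DecidableEq V]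
    (G : SimpleGraph V) [DecidableRel G.Adj] {x : V → ℤ} (hx : ∀ v, x v = 0 ∨ x v = 1) :
    dominationNumber G ≤ (Finset.univ.filter fun v => x v = 1).card +
      (Finset.univ.filter fun v => x v = 0 ∧ ∀ u ∈ G.neighborFinset v, x u = 0).card := by
  refine (dominationNumber_le_card fun v => ?_).trans (Finset.card_union_le _ _)
  by_cases h : x v = 0 ∧ ∀ u ∈ G.neighborFinset v, x u = 0
  · exact Or.inl (by simpa using Or.inr (by simpa using h))
  · rcases hx v with h0 | h1
    · push Not at h
      obtain ⟨u, hu, hu0⟩ := h h0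
      refine Or.inr ⟨u, ?_, by simpa using hu⟩
      simp [(hx u).resolve_left hu0]
    · exact Or.inl (by simp [h1])

theorem isDominatingSet_of_card_undominated_eq_zero {V : Type*} [Fintype V] [DecidableEq V]
    {G : SimpleGraph V} [DecidableRel G.Adj] {x : V → ℤ} (hx : ∀ v, x v = 0 ∨ x v = 1)
    (h : (Finset.univ.filter fun v => x v = 0 ∧ ∀ u ∈ G.neighborFinset v, x u = 0).card = 0) :
    IsDominatingSet G (Finset.univ.filter fun v => x v = 1) := by
  intro v
  rw [Finset.card_eq_zero, Finset.filter_eq_empty_iff] at h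
  rcases hx v with h0 | h1
  · have hv := h (Finset.mem_univ v)
    push Not at hv
    obtain ⟨u, hu, hu0⟩ := hv h0
    exact Or.inr ⟨u, by simp [(hx u).resolve_left hu0], by simpa using hu⟩
  · exact Or.inl (by simp [h1])

/-- For a dominating set, the surplus variables can encode the excess coverage exactly. -/
theorem IsDominatingSet.exists_dinneenHuaF_eq_card {V : Type*} [Fintype V] [DecidableEq V]
    {G : SimpleGraph V} [DecidableRel G.Adj] {D : Finset V} (hD : IsDominatingSet G D) (P : ℝ) :
    ∃ (x : V → ℤ) (y : V → ℕ → ℤ), (∀ v, x v = 0 ∨ x v = 1) ∧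
      (∀ v k, y v k = 0 ∨ y v k = 1) ∧ (D.card : ℝ) = dinneenHuaF G P x y := by
  let c : V → ℕ := fun v => if v ∈ D then 1 else 0
  let s : V → ℕ := fun v => c v + ∑ u ∈ G.neighborFinset v, c u - 1
  have hc (v) : c v ≤ 1 := by dsimp only [c]; split_ifs <;> simp
  have hpos (v) : 1 ≤ c v + ∑ u ∈ G.neighborFinset v, c u := by
    rcases hD v with h | ⟨u, hu, hvu⟩
    · simp [c, h]
    · have := Finset.single_le_sum (f := c) (fun _ _ => Nat.zero_le _)
        ((G.mem_neighborFinset v u).2 hvu)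
      have hcu : c u = 1 := if_pos hu
      omega
  have hlt (v) : s v < 2 ^ (Nat.log 2 (G.degree v) + 1) := by
    have hsum : ∑ u ∈ G.neighborFinset v, c u ≤ _ :=
      Finset.sum_le_card_nsmul (G.neighborFinset v) c 1 fun u _ => hc u
    rw [G.card_neighborFinset_eq_degree, smul_eq_mul, mul_one] at hsum
    have hv := hc v
    have hlog := Nat.lt_pow_succ_log_self one_lt_two (G.degree v)
    dsimp only [s]
    rw [Nat.succ_eq_add_one] at hlog
    omega
  refine ⟨fun v => c v, fun v k => ((s v / 2 ^ k % 2 : ℕ) : ℤ), fun v => ?_, fun v k => ?_, ?_⟩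
  · have := hc v
    dsimp only
    omega
  · dsimp only
    omega
  · have hpen (v) : (1 - ((c v : ℤ) + ∑ u ∈ G.neighborFinset v, (c u : ℤ)) +
        ∑ k ∈ Finset.range (Nat.log 2 (G.degree v) + 1),
          2 ^ k * ((s v / 2 ^ k % 2 : ℕ) : ℤ)) = 0 := by
      have hsum := sum_two_pow_mul_div_two_pow_mod_two (s v) (Nat.log 2 (G.degree v) + 1)
      rw [Nat.mod_eq_of_lt (hlt v)] at hsum
      have hsv : s v + 1 = c v + ∑ u ∈ G.neighborFinset v, c u := Nat.sub_add_cancel (hpos v)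
      zify at hsum hsv
      push_cast
      linarith
    unfold dinneenHuaF
    simp only [hpen]
    simp [c]

/-- For a finite simple graph `G` in which every vertex has
degree at least `1` and a penalty coefficient `P > 1`, the minimum of the
Dinneen–Hua QUBO objective over all binary `(x, y)` equals the domination number
`γ(G)`, and every minimizer's set `{v : x* v = 1}` is a minimum dominating set. -/
theorem dinneen_hua_qubo_min {V : Type*} [Fintype V] [DecidableEq V]
    (G : SimpleGraph V) [DecidableRel G.Adj]
    (hdeg : ∀ v, 1 ≤ G.degree v) (P : ℝ) (hP : 1 < P) :
    IsLeast {r : ℝ | ∃ (x : V → ℤ) (y : V → ℕ → ℤ),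
        (∀ v, x v = 0 ∨ x v = 1) ∧ (∀ v k, y v k = 0 ∨ y v k = 1) ∧
        r = dinneenHuaF G P x y} ((dominationNumber G : ℝ)) ∧
      ∀ (x : V → ℤ) (y : V → ℕ → ℤ),
        (∀ v, x v = 0 ∨ x v = 1) → (∀ v k, y v k = 0 ∨ y v k = 1) →
        dinneenHuaF G P x y = (dominationNumber G : ℝ) →
        IsDominatingSet G (Finset.univ.filter fun v => x v = 1) ∧
          (Finset.univ.filter fun v => x v = 1).card = dominationNumber G := by
  refine ⟨⟨?_, ?_⟩, ?_⟩
  · obtain ⟨D, hD, hcard⟩ := exists_isDominatingSet_card_eq_dominationNumber G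
    rw [← hcard]
    exact hD.exists_dinneenHuaF_eq_card P
  · rintro r ⟨x, y, hx, hy, rfl⟩
    refine le_trans ?_
      (card_add_mul_card_undominated_le_dinneenHuaF G (zero_le_one.trans hP.le) hx hy)
    refine (Nat.cast_le.2 (dominationNumber_le_card_add_card_undominated G hx)).trans ?_
    push_cast
    gcongr
    exact le_mul_of_one_le_left (Nat.cast_nonneg _) hP.le
  · intro x y hx hy hF
    have hlower := card_add_mul_card_undominated_le_dinneenHuaF G (zero_le_one.trans hP.le) hx hy
    have hγ := dominationNumber_le_card_add_card_undominated G hx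
    rw [hF] at hlower
    set U := Finset.univ.filter fun v => x v = 0 ∧ ∀ u ∈ G.neighborFinset v, x u = 0
    have hγ' : (dominationNumber G : ℝ) ≤
        ((Finset.univ.filter fun v => x v = 1).card : ℝ) + (U.card : ℝ) := by
      rw [← Nat.cast_add]
      exact Nat.cast_le.2 hγ
    have hU0 : U.card = 0 := by
      by_contra h
      have hpos : (0 : ℝ) < U.card := by exact_mod_cast Nat.pos_of_ne_zero h
      nlinarith
    have hD := isDominatingSet_of_card_undominated_eq_zero hx hU0
    refine ⟨hD, le_antisymm ?_ (dominationNumber_le_card hD)⟩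
    rw [hU0, Nat.cast_zero, mul_zero, add_zero] at hlower
    exact_mod_cast hlower
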